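/- arXiv:1908.02096 — 5 statements merged into one kernel-verified Lean document; each statement's English description precedes it below -/
import Mathlib

section
/- Let k ≥ 2 and let F ∈ [0,1]^{k×k} satisfy F_{jℓ} + F_{ℓj} = 1 for all 0 ≤ j,ℓ ≤ k−1, and let F̃ = (2F − 1_{k×k})·i ∈ ℂ^{k×k}. Then F̃ has a nondistinguishing image (i.e., two rows of the orthogonal projection P_{Im(F̃)} onto the column space of F̃ coincide) if and only if there exist 0 ≤ j ≠ ℓ ≤ k−1 such that the rows F(j,·) and F(ℓ,·) are equal. -/
/-- `P` is the orthogonal projection onto the column space (image) of `H`: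
it is Hermitian, idempotent, and has the same range as `H`. -/
def IsProjOntoImage {m : Type*} [Fintype m] [DecidableEq m] (H P : Matrix m m ℂ) : Prop :=
  P.IsHermitian ∧ P * P = P ∧
    LinearMap.range P.mulVecLin = LinearMap.range H.mulVecLin

/-- If the column space of `A` is contained in that of `B`, equal rows of `B` force equal rows
of `A`. -/
theorem Matrix.row_eq_of_range_mulVecLin_le {m n p R : Type*} [Fintype n] [Fintype p]
    [CommSemiring R] {A : Matrix m n R} {B : Matrix m p R}
    (h : LinearMap.range A.mulVecLin ≤ LinearMap.range B.mulVecLin) {j l : m}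
    (hB : ∀ q, B j q = B l q) (q : n) : A j q = A l q := by
  classical
  obtain ⟨y, hy⟩ := h ⟨Pi.single q 1, rfl⟩
  have hA (i : m) : A i q = (B.mulVec y) i := by
    simpa using (congrFun hy i).symm
  simp only [hA, Matrix.mulVec, dotProduct, hB]

/-- Proposition 1: for `F ∈ [0,1]^{k×k}` with `F_{jl} + F_{lj} = 1` and
`F̃ = (2F − 1_{k×k})·i`, the matrix `F̃` has a nondistinguishing image
(two rows of the orthogonal projection onto `Im F̃` coincide) iff two rows of `F`
are equal. -/
theorem nondistinguishing_iff_equal_rows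
    (k : ℕ) (hk : 2 ≤ k) (F : Matrix (Fin k) (Fin k) ℝ)
    (hF0 : ∀ j l, 0 ≤ F j l) (hF1 : ∀ j l, F j l ≤ 1)
    (hF : ∀ j l, F j l + F l j = 1)
    (Ft : Matrix (Fin k) (Fin k) ℂ)
    (hFt : ∀ j l, Ft j l = ((2 * F j l - 1 : ℝ) : ℂ) * Complex.I)
    (P : Matrix (Fin k) (Fin k) ℂ)
    (hP : IsProjOntoImage Ft P) :
    (∃ j l : Fin k, j ≠ l ∧ ∀ m, P j m = P l m) ↔
      (∃ j l : Fin k, j ≠ l ∧ ∀ m, F j m = F l m) := by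
  have hrow (j l : Fin k) : (∀ m, Ft j m = Ft l m) ↔ ∀ m, F j m = F l m := by
    refine forall_congr' fun m => ?_
    rw [hFt, hFt, mul_left_inj' Complex.I_ne_zero, Complex.ofReal_inj]
    constructor <;> intro h <;> linarith
  have hrange := hP.2.2
  refine exists_congr fun j => exists_congr fun l => and_congr_right fun _ => ?_
  rw [← hrow]
  exact ⟨Matrix.row_eq_of_range_mulVecLin_le hrange.ge,
    Matrix.row_eq_of_range_mulVecLin_le hrange.le⟩
end

section
/- Let S ∈ ℝ^{N×N} be a real skew-symmetric matrix and let A = i·S, which is Hermitian. Then: (a) if v ∈ ℂ^N satisfies Av = λv with λ ∈ ℝ, then the entrywise complex conjugate v̄ satisfies A v̄ = −λ v̄; in particular the spectrum of A is symmetric about 0; (b) for every ε > 0, the orthogonal projection P onto the direct sum of the eigenspaces of A corresponding to eigenvalues λ with |λ| > ε is a matrix with all entries real. -/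
/-- `P` is the spectral projection of the Hermitian matrix `A` associated with the
set `S ⊆ ℝ` of eigenvalues: it is Hermitian, idempotent, fixes every eigenvector
of `A` whose eigenvalue lies in `S`, and annihilates every eigenvector of `A`
whose eigenvalue lies outside `S`. -/
def IsSpectralProjection {m : Type*} [Fintype m] [DecidableEq m]
    (A P : Matrix m m ℂ) (S : Set ℝ) : Prop :=
  P.IsHermitian ∧ P * P = P ∧
    ∀ (lam : ℝ) (v : m → ℂ), A.mulVec v = (lam : ℂ) • v →
      (lam ∈ S → P.mulVec v = v) ∧ (lam ∉ S → P.mulVec v = 0)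

/-- Two matrices that agree on every eigenvector of a Hermitian matrix are equal. -/
theorem Matrix.IsHermitian.eq_of_mulVec_eigenvector_eq {m : Type*} [Fintype m] [DecidableEq m]
    {A P Q : Matrix m m ℂ} (hA : A.IsHermitian)
    (h : ∀ (lam : ℝ) (v : m → ℂ), A.mulVec v = (lam : ℂ) • v → P.mulVec v = Q.mulVec v) :
    P = Q := by
  apply (Matrix.toLin' (R := ℂ)).injective
  refine (hA.eigenvectorBasis.toBasis.map (WithLp.linearEquiv 2 ℂ (m → ℂ))).ext fun i => ?_
  have hi := hA.mulVec_eigenvectorBasis i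
  simpa using h (hA.eigenvalues i) _ (by simpa using hi)

theorem Matrix.map_star_mulVec_eq {m : Type*} [Fintype m] (P : Matrix m m ℂ) (v : m → ℂ) :
    (P.map star).mulVec v = star (P.mulVec (star v)) := by
  ext i
  simp [Matrix.mulVec, dotProduct]

/-- For a real skew-symmetric `S` and `A = i·S` (which is Hermitian):
(a) if `A v = λ v` with `λ` real then `A v̄ = −λ v̄`, so the spectrum of `A` is
symmetric about `0`; (b) for every `ε > 0`, the spectral projection of `A` onto
the eigenspaces with `|λ| > ε` has all entries real. -/
theorem skew_hermitian_symmetric_spectrum_real_projection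
    (N : ℕ) (S : Matrix (Fin N) (Fin N) ℝ) (hS : S.transpose = -S)
    (A : Matrix (Fin N) (Fin N) ℂ)
    (hA : A = Complex.I • S.map (fun x => (x : ℂ))) :
    (∀ (lam : ℝ) (v : Fin N → ℂ), A.mulVec v = (lam : ℂ) • v →
        A.mulVec (star v) = ((-lam : ℝ) : ℂ) • star v) ∧
    (∀ (lam : ℝ) (v : Fin N → ℂ), v ≠ 0 → A.mulVec v = (lam : ℂ) • v →
        ∃ w : Fin N → ℂ, w ≠ 0 ∧ A.mulVec w = ((-lam : ℝ) : ℂ) • w) ∧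
    (∀ ε : ℝ, 0 < ε → ∀ P : Matrix (Fin N) (Fin N) ℂ,
        IsSpectralProjection A P {x : ℝ | ε < |x|} →
        ∀ a b, (P a b).im = 0) := by
  have hconj : A.map star = -A := by
    ext i j
    simp [hA]
  have hHerm : A.IsHermitian := by
    ext i j
    have hij : S j i = -S i j := congrFun (congrFun hS i) j
    simp [hA, hij]
  have key : ∀ (lam : ℝ) (v : Fin N → ℂ), A.mulVec v = (lam : ℂ) • v →
      A.mulVec (star v) = ((-lam : ℝ) : ℂ) • star v := by
    intro lam v hv
    have h := Matrix.map_star_mulVec_eq A (star v)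
    rw [hconj, star_star, hv, Matrix.neg_mulVec, neg_eq_iff_eq_neg] at h
    rw [h]
    ext i
    simp
  refine ⟨key, fun lam v hv h => ⟨star v, star_ne_zero.mpr hv, key lam v h⟩, ?_⟩
  rintro ε - P ⟨-, -, hP⟩ a b
  have hreal : P.map star = P := by
    refine hHerm.eq_of_mulVec_eigenvector_eq fun lam v hv => ?_
    obtain ⟨h₁, h₂⟩ := hP lam v hv
    obtain ⟨h₃, h₄⟩ := hP (-lam) (star v) (key lam v hv)
    simp only [Set.mem_ofPred_eq, abs_neg] at h₁ h₂ h₃ h₄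
    rw [Matrix.map_star_mulVec_eq]
    by_cases h : ε < |lam|
    · rw [h₁ h, h₃ h, star_star]
    · rw [h₂ h, h₄ h, star_zero]
  exact Complex.conj_eq_iff_im.mp (congrFun (congrFun hreal a) b)
end

section
/- Let k ≥ 3, η ∈ [0,1/2), and let F̃ ∈ ℂ^{k×k} be the Hermitian matrix of the cyclic block model. Then the spectral gap ρ̃ of F̃ (the minimum absolute value of its nonzero eigenvalues) satisfies ρ̃ = min{2(1−2η)|sin(2πj/k)| : 1 ≤ j ≤ k−1, sin(2πj/k) ≠ 0}, and in particular ρ̃ ≥ 2(1−2η)·sin(π/k) ≥ 4(1−2η)/k. -/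
/-- The value of `sin` at a multiple `π r / k` with `0 < r < k` is at least `sin (π / k)`. -/
theorem sin_pi_div_le_sin_nat_mul {k r : ℕ} (hr : 1 ≤ r) (hrk : r + 1 ≤ k) :
    Real.sin (Real.pi / k) ≤ Real.sin (Real.pi * r / k) := by
  have hk : (0 : ℝ) < k := by exact_mod_cast (by omega : 0 < k)
  have hr' : (1 : ℝ) ≤ r := by exact_mod_cast hr
  have hrk' : (r : ℝ) + 1 ≤ k := by exact_mod_cast hrk
  have hpi := Real.pi_pos
  have hpos : 0 < Real.pi / k := by positivity
  have hle : Real.pi / k ≤ Real.pi * r / k := by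
    gcongr
    nlinarith
  have hge : Real.pi * r / k ≤ Real.pi - Real.pi / k := by
    rw [le_sub_iff_add_le, ← add_div, div_le_iff₀ hk]
    nlinarith
  rcases le_total (Real.pi * r / k) (Real.pi / 2) with h | h
  · exact Real.sin_le_sin_of_le_of_le_pi_div_two (by linarith) h hle
  · rw [← Real.sin_pi_sub (Real.pi * r / k)]
    exact Real.sin_le_sin_of_le_of_le_pi_div_two (by linarith) (by linarith) (by linarith)

theorem sin_pi_div_le_abs_sin_two_pi_mul {k j : ℕ} (hj : 1 ≤ j) (hjk : j ≤ k - 1)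
    (hsin : Real.sin (2 * Real.pi * j / k) ≠ 0) :
    Real.sin (Real.pi / k) ≤ |Real.sin (2 * Real.pi * j / k)| := by
  have hk : (k : ℝ) ≠ 0 := by exact_mod_cast (by omega : k ≠ 0)
  rcases lt_trichotomy (2 * j) k with h | h | h
  · have h' := sin_pi_div_le_sin_nat_mul (k := k) (r := 2 * j) (by omega) (by omega)
    rw [show Real.pi * ((2 * j : ℕ) : ℝ) / k = 2 * Real.pi * j / k by push_cast; ring] at h'
    exact h'.trans (le_abs_self _)
  · refine absurd ?_ hsin
    have hkj : (k : ℝ) = 2 * j := by exact_mod_cast h.symm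
    rw [show 2 * Real.pi * j / k = Real.pi by field_simp; rw [hkj], Real.sin_pi]
  · have h' := sin_pi_div_le_sin_nat_mul (k := k) (r := 2 * j - k) (by omega) (by omega)
    rw [Nat.cast_sub h.le,
      show Real.pi * (((2 * j : ℕ) : ℝ) - k) / k = 2 * Real.pi * j / k - Real.pi by
        push_cast; field_simp, Real.sin_sub_pi] at h'
    exact h'.trans (neg_le_abs _)

theorem stdAddChar_sub_stdAddChar_neg {k : ℕ} [NeZero k] (j : ℕ) :
    Complex.I * (ZMod.stdAddChar (j : ZMod k) - ZMod.stdAddChar (-(j : ZMod k))) =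
      ((-(2 * Real.sin (2 * Real.pi * j / k)) : ℝ) : ℂ) := by
  have h1 := ZMod.stdAddChar_coe (N := k) (j : ℤ)
  have h2 := ZMod.stdAddChar_coe (N := k) (-(j : ℤ))
  push_cast at h1 h2
  rw [h1, h2]
  push_cast
  rw [Complex.sin, show 2 * (Real.pi : ℂ) * Complex.I * j / k =
    2 * Real.pi * j / k * Complex.I by ring, show 2 * (Real.pi : ℂ) * Complex.I * -j / k =
    -(2 * Real.pi * j / k) * Complex.I by ring]
  ring

theorem cyclic_mulVec_apply {k : ℕ} [NeZero k] (hk : 3 ≤ k) (a : ℂ)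
    {A : Matrix (ZMod k) (ZMod k) ℂ}
    (hA : ∀ j l : ZMod k, A j l = if j = l - 1 then a else if j = l + 1 then -a else 0)
    (v : ZMod k → ℂ) (j : ZMod k) :
    A.mulVec v j = a * (v (j + 1) - v (j - 1)) := by
  have h2 : (2 : ZMod k) ≠ 0 := by
    intro h
    have h' : ((2 : ℕ) : ZMod k) = 0 := by exact_mod_cast h
    rw [ZMod.natCast_eq_zero_iff] at h'
    exact absurd (Nat.le_of_dvd (by norm_num) h') (by omega)
  have hA' : ∀ l, A j l * v l =
      (if l = j + 1 then a * v l else 0) - (if l = j - 1 then a * v l else 0) := by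
    intro l
    rw [hA]
    by_cases hl : l = j + 1
    · have hne : j + 1 ≠ j - 1 := fun h => h2 (by linear_combination h)
      subst hl
      simp [hne]
    · have h3 : j ≠ l - 1 := fun h => hl (by rw [h]; ring)
      by_cases hl' : l = j - 1
      · have h4 : j = l + 1 := by rw [hl']; ring
        rw [if_neg h3, if_pos h4, if_neg hl, if_pos hl']
        ring
      · have h4 : j ≠ l + 1 := fun h => hl' (by rw [h]; ring)
        rw [if_neg h3, if_neg h4, if_neg hl, if_neg hl']
        ring
  simp only [Matrix.mulVec, dotProduct, hA', Finset.sum_sub_distrib, Finset.sum_ite_eq',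
    Finset.mem_univ, if_true]
  ring

theorem dft_comp_add {k : ℕ} [NeZero k] (v : ZMod k → ℂ) (c m : ZMod k) :
    ZMod.dft (fun j => v (j + c)) m = ZMod.stdAddChar (c * m) * ZMod.dft v m := by
  simp only [ZMod.dft_apply, smul_eq_mul]
  rw [Finset.mul_sum, ← Equiv.sum_comp (Equiv.subRight c)]
  refine Finset.sum_congr rfl fun j _ => ?_
  rw [Equiv.subRight_apply, sub_add_cancel, ← mul_assoc, ← AddChar.map_add_eq_mul]
  congr 2
  ring

/-- The character `l ↦ ζ ^ (j l)` is an eigenvector with eigenvalue `-2 c sin (2 π j / k)`, and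
the Fourier transform shows that there are no other eigenvalues. -/
theorem cyclic_eigenvalue_iff {k : ℕ} [NeZero k] (hk : 3 ≤ k) (c : ℝ)
    {A : Matrix (ZMod k) (ZMod k) ℂ}
    (hA : ∀ j l : ZMod k, A j l = if j = l - 1 then (c : ℂ) * Complex.I
      else if j = l + 1 then -((c : ℂ) * Complex.I) else 0) (lam : ℝ) :
    (∃ v : ZMod k → ℂ, v ≠ 0 ∧ A.mulVec v = (lam : ℂ) • v) ↔
      ∃ j : ℕ, j < k ∧ lam = -(2 * c * Real.sin (2 * Real.pi * j / k)) := by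
  have key := fun j : ℕ => stdAddChar_sub_stdAddChar_neg (k := k) j
  constructor
  · rintro ⟨v, hv, hlam⟩
    obtain ⟨m, hm⟩ : ∃ m, ZMod.dft v m ≠ 0 := by
      by_contra! h
      exact hv (ZMod.dft.map_eq_zero_iff.mp (funext h))
    refine ⟨m.val, m.val_lt, ?_⟩
    have hfun : (lam : ℂ) • v =
        ((c : ℂ) * Complex.I) • ((fun j => v (j + 1)) - fun j => v (j + -1)) := by
      rw [← hlam]
      ext j
      simp [cyclic_mulVec_apply hk _ hA, sub_eq_add_neg]
    have h := congrFun (congrArg ZMod.dft hfun) m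
    rw [map_smul, map_smul, map_sub] at h
    simp only [Pi.smul_apply, Pi.sub_apply, dft_comp_add, smul_eq_mul, one_mul, neg_mul] at h
    have key' := key m.val
    rw [ZMod.natCast_zmod_val] at key'
    have h' : (lam : ℂ) = ((-(2 * c * Real.sin (2 * Real.pi * m.val / k)) : ℝ) : ℂ) := by
      apply mul_right_cancel₀ hm
      rw [h]
      push_cast at key' ⊢
      linear_combination (c : ℂ) * ZMod.dft v m * key'
    exact_mod_cast h'
  · rintro ⟨j, -, rfl⟩
    refine ⟨fun l => ZMod.stdAddChar (l * (j : ZMod k)), fun h => ?_, ?_⟩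
    · simpa using congrFun h 0
    · ext l
      rw [cyclic_mulVec_apply hk _ hA, Pi.smul_apply, smul_eq_mul, add_mul, sub_mul, one_mul,
        sub_eq_add_neg (l * (j : ZMod k)), AddChar.map_add_eq_mul, AddChar.map_add_eq_mul]
      have key' := key j
      push_cast at key' ⊢
      linear_combination (c : ℂ) * ZMod.stdAddChar (l * (j : ZMod k)) * key'


/-- The spectral gap `ρ̃` of the cyclic block model matrix `F̃` (the least element of
the set of absolute values of nonzero eigenvalues of `F̃`) equals
`min { 2(1−2η)|sin(2πj/k)| : 1 ≤ j ≤ k−1, sin(2πj/k) ≠ 0 }`, and in particular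
`ρ̃ ≥ 2(1−2η)·sin(π/k) ≥ 4(1−2η)/k`. -/
theorem cyclic_block_model_spectral_gap
    (k : ℕ) [NeZero k] (hk : 3 ≤ k) (η : ℝ) (hη0 : 0 ≤ η) (hη : η < 1 / 2)
    (Ft : Matrix (ZMod k) (ZMod k) ℂ)
    (hFt : ∀ j l : ZMod k, Ft j l =
      if j = l - 1 then ((1 - 2 * η : ℝ) : ℂ) * Complex.I
      else if j = l + 1 then -(((1 - 2 * η : ℝ) : ℂ) * Complex.I) else 0)
    (gap : ℝ)
    (hgap : IsLeast {x : ℝ | ∃ (lam : ℝ) (v : ZMod k → ℂ), v ≠ 0 ∧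
        Ft.mulVec v = (lam : ℂ) • v ∧ lam ≠ 0 ∧ x = |lam|} gap) :
    IsLeast {x : ℝ | ∃ j : ℕ, 1 ≤ j ∧ j ≤ k - 1 ∧
        Real.sin (2 * Real.pi * (j : ℝ) / (k : ℝ)) ≠ 0 ∧
        x = 2 * (1 - 2 * η) * |Real.sin (2 * Real.pi * (j : ℝ) / (k : ℝ))|} gap ∧
    2 * (1 - 2 * η) * Real.sin (Real.pi / (k : ℝ)) ≤ gap ∧
    4 * (1 - 2 * η) / (k : ℝ) ≤ gap := by
  have hc : 0 < 1 - 2 * η := by linarith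
  have hset : {x : ℝ | ∃ (lam : ℝ) (v : ZMod k → ℂ), v ≠ 0 ∧
        Ft.mulVec v = (lam : ℂ) • v ∧ lam ≠ 0 ∧ x = |lam|} =
      {x : ℝ | ∃ j : ℕ, 1 ≤ j ∧ j ≤ k - 1 ∧
        Real.sin (2 * Real.pi * (j : ℝ) / (k : ℝ)) ≠ 0 ∧
        x = 2 * (1 - 2 * η) * |Real.sin (2 * Real.pi * (j : ℝ) / (k : ℝ))|} := by
    have habs (y : ℝ) : |-(2 * (1 - 2 * η) * y)| = 2 * (1 - 2 * η) * |y| := by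
      rw [abs_neg, abs_mul, abs_of_pos (by linarith)]
    ext x
    constructor
    · rintro ⟨lam, v, hv, hlam, h0, rfl⟩
      obtain ⟨j, hj, rfl⟩ := (cyclic_eigenvalue_iff hk _ hFt lam).mp ⟨v, hv, hlam⟩
      have hsin : Real.sin (2 * Real.pi * j / k) ≠ 0 := fun h => h0 (by rw [h]; simp)
      have hj0 : j ≠ 0 := by
        rintro rfl
        simp at hsin
      exact ⟨j, by omega, by omega, hsin, habs _⟩
    · rintro ⟨j, hj, hjk, hsin, rfl⟩
      obtain ⟨v, hv, hlam⟩ := (cyclic_eigenvalue_iff hk _ hFt _).mpr ⟨j, by omega, rfl⟩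
      exact ⟨_, v, hv, hlam, neg_ne_zero.mpr (mul_ne_zero (by linarith) hsin), (habs _).symm⟩
  rw [hset] at hgap
  have hsin_le : 2 * (1 - 2 * η) * Real.sin (Real.pi / k) ≤ gap := by
    obtain ⟨j, hj, hjk, hsin, rfl⟩ := hgap.1
    gcongr
    exact sin_pi_div_le_abs_sin_two_pi_mul hj hjk hsin
  refine ⟨hgap, hsin_le, le_trans ?_ hsin_le⟩
  have hjordan : 2 / (k : ℝ) ≤ Real.sin (Real.pi / k) := by
    have hle : Real.pi / k ≤ Real.pi / 2 := by
      gcongr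
      exact_mod_cast (by omega : 2 ≤ k)
    have h := Real.mul_le_sin (by positivity) hle
    rwa [show 2 / Real.pi * (Real.pi / k) = 2 / (k : ℝ) by field_simp] at h
  calc 4 * (1 - 2 * η) / (k : ℝ) = 2 * (1 - 2 * η) * (2 / k) := by ring
    _ ≤ _ := by gcongr
end

section
/- Let H, Â ∈ ℂ^{N×N} be Hermitian matrices and γ > 0 such that every nonzero eigenvalue λ of H satisfies |λ| ≥ γ. Let Q be the orthogonal projection onto the image of H. Let ε > 0 satisfy ‖Â − H‖ ≤ ε/2 and γ ≥ 3ε, and let P be the orthogonal projection onto the span of the eigenvectors of Â whose eigenvalues λ satisfy |λ| > ε. Then ‖P − Q‖ ≤ 2‖Â − H‖/(γ − 2ε). -/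
/-- The spectral norm (ℓ²-operator norm) of a complex square matrix. -/
noncomputable def specNorm {m : Type*} [Fintype m] [DecidableEq m] (M : Matrix m m ℂ) : ℝ :=
  ‖Matrix.toEuclideanCLM (𝕜 := ℂ) M‖

section SpectralBounds

variable {E : Type*} [NormedAddCommGroup E] [InnerProductSpace ℂ E]

theorem ContinuousLinearMap.mul_opNorm_le_opNorm_mul {S T : E →L[ℂ] E} {c : ℝ} (hc : 0 < c)
    (h : ∀ x, c * ‖S x‖ ≤ ‖T (S x)‖) : c * ‖S‖ ≤ ‖T * S‖ := by
  rw [mul_comm, ← le_div_iff₀ hc]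
  refine S.opNorm_le_bound (by positivity) fun x => ?_
  rw [div_mul_eq_mul_div, le_div_iff₀ hc, mul_comm]
  exact (h x).trans ((T * S).le_opNorm x)

variable [FiniteDimensional ℂ E]

theorem IsSelfAdjoint.exists_orthonormal_eigenbasis {T : E →L[ℂ] E} (hT : IsSelfAdjoint T) :
    ∃ (b : OrthonormalBasis (Fin (Module.finrank ℂ E)) ℂ E) (μ : Fin (Module.finrank ℂ E) → ℝ),
      ∀ i, T (b i) = (μ i : ℂ) • b i := by
  have hs := ContinuousLinearMap.isSelfAdjoint_iff_isSymmetric.mp hT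
  exact ⟨hs.eigenvectorBasis rfl, hs.eigenvalues rfl, fun i => hs.apply_eigenvectorBasis rfl i⟩

theorem IsSelfAdjoint.inner_apply_eq {T : E →L[ℂ] E} (hT : IsSelfAdjoint T) (x y : E) :
    inner ℂ (T x) y = inner ℂ x (T y) :=
  ContinuousLinearMap.isSelfAdjoint_iff_isSymmetric.mp hT x y

theorem IsSelfAdjoint.inner_eigenvector_apply {T : E →L[ℂ] E} (hT : IsSelfAdjoint T) {v : E}
    {μ : ℝ} (hv : T v = (μ : ℂ) • v) (x : E) :
    inner ℂ v (T x) = (μ : ℂ) * inner ℂ v x := by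
  rw [← hT.inner_apply_eq, hv, inner_smul_left, Complex.conj_ofReal]

/-- A self-adjoint operator shifted by a real number `t` is bounded below by `c` on vectors
supported on eigenvectors whose eigenvalues are at distance at least `c` from `t`. -/
theorem IsSelfAdjoint.mul_norm_le_norm_apply_sub {ι : Type*} [Fintype ι] {T : E →L[ℂ] E}
    (hT : IsSelfAdjoint T) (b : OrthonormalBasis ι ℂ E) (μ : ι → ℝ)
    (hb : ∀ i, T (b i) = (μ i : ℂ) • b i) {c t : ℝ} (hc : 0 ≤ c) (x : E)
    (h : ∀ i, inner ℂ (b i) x ≠ 0 → c ≤ |μ i - t|) :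
    c * ‖x‖ ≤ ‖T x - (t : ℂ) • x‖ := by
  refine le_of_sq_le_sq ?_ (norm_nonneg _)
  rw [mul_pow, ← b.sum_sq_norm_inner_right, ← b.sum_sq_norm_inner_right, Finset.mul_sum]
  refine Finset.sum_le_sum fun i _ => ?_
  rw [inner_sub_right, hT.inner_eigenvector_apply (hb i), inner_smul_right, ← sub_mul,
    ← Complex.ofReal_sub, norm_mul, Complex.norm_real, Real.norm_eq_abs, mul_pow]
  by_cases hi : inner ℂ (b i) x = 0
  · simp [hi]
  · gcongr
    exact h i hi

/-- A self-adjoint operator is bounded by `c` on vectors supported on eigenvectors whose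
eigenvalues have absolute value at most `c`. -/
theorem IsSelfAdjoint.norm_apply_le_mul_norm {ι : Type*} [Fintype ι] {T : E →L[ℂ] E}
    (hT : IsSelfAdjoint T) (b : OrthonormalBasis ι ℂ E) (μ : ι → ℝ)
    (hb : ∀ i, T (b i) = (μ i : ℂ) • b i) {c : ℝ} (hc : 0 ≤ c) (x : E)
    (h : ∀ i, inner ℂ (b i) x ≠ 0 → |μ i| ≤ c) :
    ‖T x‖ ≤ c * ‖x‖ := by
  refine le_of_sq_le_sq ?_ (by positivity)
  rw [mul_pow, ← b.sum_sq_norm_inner_right, ← b.sum_sq_norm_inner_right, Finset.mul_sum]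
  refine Finset.sum_le_sum fun i _ => ?_
  rw [hT.inner_eigenvector_apply (hb i), norm_mul, Complex.norm_real, Real.norm_eq_abs, mul_pow]
  by_cases hi : inner ℂ (b i) x = 0
  · simp [hi]
  · gcongr
    exact h i hi

/-- Weyl-type bound: if every nonzero eigenvalue of `H` has absolute value at least `γ`, an
eigenvalue of a perturbation `A` larger than `‖A - H‖` in absolute value is at least
`γ - ‖A - H‖` in absolute value. -/
theorem IsSelfAdjoint.gap_sub_le_abs_eigenvalue {A H : E →L[ℂ] E} (hH : IsSelfAdjoint H) {γ : ℝ}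
    (hgap : ∀ (μ : ℝ) (v : E), v ≠ 0 → H v = (μ : ℂ) • v → μ ≠ 0 → γ ≤ |μ|)
    {μ : ℝ} {v : E} (hv : v ≠ 0) (hA : A v = (μ : ℂ) • v) (hμ : ‖A - H‖ < |μ|) :
    γ - ‖A - H‖ ≤ |μ| := by
  by_contra! hlt
  obtain ⟨b, ν, hb⟩ := hH.exists_orthonormal_eigenbasis
  have hc : ‖A - H‖ < min |μ| (γ - |μ|) := lt_min hμ (by linarith)
  have hlow := hH.mul_norm_le_norm_apply_sub b ν hb (c := min |μ| (γ - |μ|)) (t := μ)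
    ((norm_nonneg _).trans hc.le) v fun i _ => by
      by_cases h0 : ν i = 0
      · simp [h0]
      · have h1 := hgap (ν i) (b i) (by simpa using b.toBasis.ne_zero i) (hb i) h0
        have h2 := abs_sub_abs_le_abs_sub (ν i) μ
        exact (min_le_right _ _).trans (by linarith)
  have hE : ‖H v - (μ : ℂ) • v‖ ≤ ‖A - H‖ * ‖v‖ := by
    rw [← hA, norm_sub_rev]
    exact (A - H).le_opNorm v
  have hvpos : 0 < ‖v‖ := norm_pos_iff.mpr hv
  nlinarith

/-- Davis–Kahan-type bound for self-adjoint operators on a finite-dimensional space. -/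
theorem IsStarProjection.norm_sub_le_of_spectral_gap {A H P Q : E →L[ℂ] E}
    (hA : IsSelfAdjoint A) (hH : IsSelfAdjoint H) (hP : IsStarProjection P)
    (hQ : IsStarProjection Q) {γ ε : ℝ} (hε : 0 < ε)
    (hgap : ∀ (μ : ℝ) (v : E), v ≠ 0 → H v = (μ : ℂ) • v → μ ≠ 0 → γ ≤ |μ|)
    (hrange : ∀ y, (∃ x, Q x = y) ↔ ∃ x, H x = y)
    (hclose : ‖A - H‖ ≤ ε / 2) (hγε : 3 * ε ≤ γ)
    (hPA : ∀ (μ : ℝ) (v : E), A v = (μ : ℂ) • v →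
      (ε < |μ| → P v = v) ∧ (¬ ε < |μ| → P v = 0)) :
    ‖P - Q‖ ≤ 2 * ‖A - H‖ / (γ - ε) := by
  obtain ⟨a, α, ha⟩ := hA.exists_orthonormal_eigenbasis
  obtain ⟨b, ν, hb⟩ := hH.exists_orthonormal_eigenbasis
  have ha0 : ∀ i, a i ≠ 0 := fun i => by simpa using a.toBasis.ne_zero i
  have hb0 : ∀ i, b i ≠ 0 := fun i => by simpa using b.toBasis.ne_zero i
  have hcomm : A * P = P * A := by
    refine ContinuousLinearMap.coe_injective (a.toBasis.ext fun i => ?_)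
    by_cases hi : ε < |α i|
    · simp [ha, (hPA _ _ (ha i)).1 hi]
    · simp [ha, (hPA _ _ (ha i)).2 hi]
  have hQH : Q * H = H := by
    ext x
    obtain ⟨y, hy⟩ := (hrange (H x)).2 ⟨x, rfl⟩
    have := congrArg (fun T : E →L[ℂ] E => T y) hQ.isIdempotentElem.eq
    simpa [hy] using this
  have hHQ : H * Q = H := by
    simpa [hH.star_eq, hQ.isSelfAdjoint.star_eq] using congrArg star hQH
  have hPle := hP.norm_le
  have hQle := hQ.norm_le
  have hP'le := hP.one_sub.norm_le
  have hQ'le := hQ.one_sub.norm_le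
  have hAP' : ‖A * (1 - P)‖ ≤ ε := by
    refine ContinuousLinearMap.opNorm_le_bound _ hε.le fun x => ?_
    refine (hA.norm_apply_le_mul_norm a α ha hε.le ((1 - P) x) fun i hi => ?_).trans ?_
    · by_contra! hlt
      refine hi ?_
      rw [← hP.one_sub.isSelfAdjoint.inner_apply_eq]
      simp [(hPA _ _ (ha i)).1 hlt]
    · gcongr
      simpa using (1 - P).le_of_opNorm_le hP'le x
  have hW : (γ - ε) * ‖Q * (1 - P)‖ ≤ ‖A - H‖ := by
    have h1 : γ * ‖Q * (1 - P)‖ ≤ ‖H * (Q * (1 - P))‖ := by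
      refine ContinuousLinearMap.mul_opNorm_le_opNorm_mul (by linarith) fun x => ?_
      obtain ⟨z, hz⟩ := (hrange ((Q * (1 - P)) x)).1 ⟨(1 - P) x, rfl⟩
      have := hH.mul_norm_le_norm_apply_sub b ν hb (c := γ) (t := 0) (by linarith)
        ((Q * (1 - P)) x) fun i hi => by
          rw [sub_zero]
          refine hgap _ _ (hb0 i) (hb i) fun h0 => hi ?_
          rw [← hz, hH.inner_eigenvector_apply (hb i), h0]
          simp
      simpa using this
    have h2 : H * (Q * (1 - P)) = (Q * (1 - P)) * (A * (1 - P)) - Q * (A - H) * (1 - P) := by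
      have e1 : (1 - P) * (A * (1 - P)) = A * (1 - P) := by
        rw [← mul_assoc, show (1 - P) * A = A * (1 - P) by rw [mul_sub, sub_mul, hcomm]; simp,
          mul_assoc, hP.one_sub.isIdempotentElem.eq]
      rw [mul_assoc Q, e1, mul_sub Q A H, hQH, ← mul_assoc, hHQ, sub_mul, mul_assoc Q A]
      abel
    have h3 : ‖Q * (A - H) * (1 - P)‖ ≤ ‖A - H‖ := by
      calc _ ≤ ‖Q‖ * ‖A - H‖ * ‖1 - P‖ := norm_mul₃_le
        _ ≤ 1 * ‖A - H‖ * 1 := by gcongr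
        _ = _ := by ring
    have h4 : ‖(Q * (1 - P)) * (A * (1 - P))‖ ≤ ‖Q * (1 - P)‖ * ε :=
      (norm_mul_le _ _).trans (by gcongr)
    have h5 := norm_sub_le ((Q * (1 - P)) * (A * (1 - P))) (Q * (A - H) * (1 - P))
    rw [← h2] at h5
    linarith
  have hY : (γ - ‖A - H‖) * ‖P * (1 - Q)‖ ≤ ‖A - H‖ := by
    have h1 : (γ - ‖A - H‖) * ‖P * (1 - Q)‖ ≤ ‖A * (P * (1 - Q))‖ := by
      refine ContinuousLinearMap.mul_opNorm_le_opNorm_mul (by linarith) fun x => ?_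
      have := hA.mul_norm_le_norm_apply_sub a α ha (c := γ - ‖A - H‖) (t := 0) (by linarith)
        ((P * (1 - Q)) x) fun i hi => by
          rw [sub_zero]
          refine hH.gap_sub_le_abs_eigenvalue hgap (ha0 i) (ha i) ?_
          by_contra! hle
          refine hi ?_
          rw [mul_apply_eq_comp, ← hP.isSelfAdjoint.inner_apply_eq,
            (hPA _ _ (ha i)).2 (by linarith), inner_zero_left]
      simpa using this
    have h2 : A * (P * (1 - Q)) = P * (A - H) * (1 - Q) := by
      have e1 : H * (1 - Q) = 0 := by rw [mul_sub, hHQ]; simp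
      rw [← mul_assoc, hcomm, mul_assoc P (A - H), sub_mul, e1, sub_zero, mul_assoc]
    have h3 : ‖P * (A - H) * (1 - Q)‖ ≤ ‖A - H‖ := by
      calc _ ≤ ‖P‖ * ‖A - H‖ * ‖1 - Q‖ := norm_mul₃_le
        _ ≤ 1 * ‖A - H‖ * 1 := by gcongr
        _ = _ := by ring
    rw [h2] at h1
    exact h1.trans h3
  have hsplit : P - Q = star (P * (1 - Q)) - Q * (1 - P) := by
    rw [star_mul, hQ.one_sub.isSelfAdjoint.star_eq, hP.isSelfAdjoint.star_eq]
    noncomm_ring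
  have hstar : ‖star (P * (1 - Q))‖ = ‖P * (1 - Q)‖ :=
    ContinuousLinearMap.adjoint.norm_map _
  have htri := norm_sub_le (star (P * (1 - Q))) (Q * (1 - P))
  rw [← hsplit, hstar] at htri
  rw [le_div_iff₀ (by linarith)]
  have hY0 := norm_nonneg (P * (1 - Q))
  nlinarith

end SpectralBounds

theorem Matrix.IsHermitian.isSelfAdjoint_toEuclideanCLM {m : Type*} [Fintype m] [DecidableEq m]
    {M : Matrix m m ℂ} (hM : M.IsHermitian) :
    IsSelfAdjoint (Matrix.toEuclideanCLM (𝕜 := ℂ) M) :=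
  IsSelfAdjoint.map (show IsSelfAdjoint M from hM) _

theorem Matrix.toEuclideanCLM_apply_eq_iff {m : Type*} [Fintype m] [DecidableEq m]
    (M : Matrix m m ℂ) (x y : EuclideanSpace ℂ m) :
    Matrix.toEuclideanCLM (𝕜 := ℂ) M x = y ↔ M.mulVec x.ofLp = y.ofLp := by
  rw [← Matrix.ofLp_toEuclideanCLM]
  exact (WithLp.ofLp_injective 2).eq_iff.symm

theorem Matrix.exists_toEuclideanCLM_apply_eq_iff {m : Type*} [Fintype m] [DecidableEq m]
    (M : Matrix m m ℂ) (y : EuclideanSpace ℂ m) :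
    (∃ x, Matrix.toEuclideanCLM (𝕜 := ℂ) M x = y) ↔ y.ofLp ∈ LinearMap.range M.mulVecLin := by
  simp only [Matrix.toEuclideanCLM_apply_eq_iff, LinearMap.mem_range, Matrix.mulVecLin_apply]
  exact ⟨fun ⟨x, hx⟩ => ⟨x.ofLp, hx⟩, fun ⟨x, hx⟩ => ⟨WithLp.toLp 2 x, hx⟩⟩

/-- A Davis–Kahan-type bound: if every nonzero eigenvalue of the Hermitian matrix `H`
has absolute value at least `γ`, `Q` is the orthogonal projection onto the image
of `H`, `Â` is Hermitian with `‖Â − H‖ ≤ ε/2` and `γ ≥ 3ε`, and `P` is the spectral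
projection of `Â` onto the eigenspaces with `|λ| > ε`, then
`‖P − Q‖ ≤ 2‖Â − H‖/(γ − 2ε)`. -/
theorem spectral_projection_perturbation
    (N : ℕ) (H Ahat : Matrix (Fin N) (Fin N) ℂ)
    (hH : H.IsHermitian) (hAhat : Ahat.IsHermitian)
    (γ : ℝ) (hγ : 0 < γ)
    (hgap : ∀ (lam : ℝ) (v : Fin N → ℂ), v ≠ 0 →
      H.mulVec v = (lam : ℂ) • v → lam ≠ 0 → γ ≤ |lam|)
    (Q : Matrix (Fin N) (Fin N) ℂ) (hQ : IsProjOntoImage H Q)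
    (ε : ℝ) (hε : 0 < ε)
    (hclose : specNorm (Ahat - H) ≤ ε / 2) (hγε : 3 * ε ≤ γ)
    (P : Matrix (Fin N) (Fin N) ℂ)
    (hP : IsSpectralProjection Ahat P {x : ℝ | ε < |x|}) :
    specNorm (P - Q) ≤ 2 * specNorm (Ahat - H) / (γ - 2 * ε) := by
  obtain ⟨hQh, hQi, hQr⟩ := hQ
  obtain ⟨hPh, hPi, hPe⟩ := hP
  unfold specNorm at *
  have key := IsStarProjection.norm_sub_le_of_spectral_gap
    (A := Matrix.toEuclideanCLM (𝕜 := ℂ) Ahat) (H := Matrix.toEuclideanCLM (𝕜 := ℂ) H)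
    (P := Matrix.toEuclideanCLM (𝕜 := ℂ) P) (Q := Matrix.toEuclideanCLM (𝕜 := ℂ) Q) (γ := γ)
    hAhat.isSelfAdjoint_toEuclideanCLM hH.isSelfAdjoint_toEuclideanCLM
    ⟨by rw [IsIdempotentElem, ← map_mul, hPi], hPh.isSelfAdjoint_toEuclideanCLM⟩
    ⟨by rw [IsIdempotentElem, ← map_mul, hQi], hQh.isSelfAdjoint_toEuclideanCLM⟩ hε
    (fun μ v hv hμ => hgap μ v.ofLp (by simpa using hv)
      ((Matrix.toEuclideanCLM_apply_eq_iff _ _ _).1 hμ))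
    (fun y => by simp only [Matrix.exists_toEuclideanCLM_apply_eq_iff, hQr])
    (by rwa [← map_sub]) hγε
    (fun μ v hv => by
      simp only [Matrix.toEuclideanCLM_apply_eq_iff]
      exact hPe μ v.ofLp ((Matrix.toEuclideanCLM_apply_eq_iff _ _ _).1 hv))
  rw [← map_sub, ← map_sub] at key
  refine key.trans ?_
  gcongr <;> linarith
end

section
/- There exists an absolute constant C₀ > 0 with the following property. Let k, n ≥ 1, N = kn, let C_0,…,C_{k−1} be a partition of {1,…,N} with |C_j| = n for all j, and let θ > 0. Let Q ∈ ℝ^{N×d} be a matrix whose rows satisfy Q(u,·) = c_j for all u ∈ C_j, where c_0,…,c_{k−1} ∈ ℝ^d satisfy ‖c_j − c_ℓ‖ ≥ θ for all j ≠ ℓ. Let P ∈ ℝ^{N×d} satisfy Σ_{u=1}^{N} ‖P(u,·) − Q(u,·)‖² ≤ Δ. Let C₁ ≥ 1 and suppose Δ ≤ nθ²/(100(C₁+1)). Then every C₁-approximate k-means clustering A_0,…,A_{k−1} of the rows of P misclassifies at most C₀·C₁·Δ/θ² vertices, i.e., min_{σ ∈ S_k} Σ_{j=0}^{k−1} (|A_{σ(j)}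 \ C_j| + |C_j \ A_{σ(j)}|) ≤ C₀·C₁·Δ/θ². -/
/-- `A` is a partition of the index set into `k` (possibly empty) parts. -/
def IsKPartition {N k : ℕ} (A : Fin k → Finset (Fin N)) : Prop :=
  (∀ u, ∃ j, u ∈ A j) ∧ ∀ j l, j ≠ l → Disjoint (A j) (A l)

/-- A partition into `k` parts is the family of fibres of a labelling function. -/
theorem IsKPartition.exists_label {N k : ℕ} {A : Fin k → Finset (Fin N)} (hA : IsKPartition A) :
    ∃ a : Fin N → Fin k, ∀ u j, u ∈ A j ↔ a u = j := by
  choose a ha using hA.1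
  refine ⟨a, fun u j => ⟨fun hu => ?_, fun h => h ▸ ha u⟩⟩
  by_contra hne
  exact Finset.disjoint_left.mp (hA.2 _ _ hne) (ha u) hu

/-- Summing over the parts of a labelled partition is summing over the ground set. -/
theorem sum_parts_eq_sum_label {N k : ℕ} {M : Type*} [AddCommMonoid M]
    {A : Fin k → Finset (Fin N)} {a : Fin N → Fin k} (ha : ∀ u j, u ∈ A j ↔ a u = j)
    (f : Fin k → Fin N → M) : ∑ j, ∑ u ∈ A j, f j u = ∑ u, f (a u) u := by
  have hfib : ∀ j, A j = Finset.univ.filter (fun u => a u = j) := fun j => by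
    ext u
    simp [ha]
  simp only [hfib, Finset.sum_filter]
  rw [Finset.sum_comm]
  simp

/-- Each element placed in the wrong part is counted exactly twice in the total size of the
symmetric differences. -/
theorem sum_card_sdiff_eq_two_mul_card_label_ne {N k : ℕ} {A C : Fin k → Finset (Fin N)}
    {a t : Fin N → Fin k} (ha : ∀ u j, u ∈ A j ↔ a u = j) (ht : ∀ u j, u ∈ C j ↔ t u = j)
    (σ : Equiv.Perm (Fin k)) :
    ∑ j, ((A (σ j) \ C j).card + (C j \ A (σ j)).card) =
      2 * (Finset.univ.filter (fun u => a u ≠ σ (t u))).card := by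
  have haσ : ∀ u j, u ∈ A (σ j) ↔ σ.symm (a u) = j := fun u j => by
    rw [ha, Equiv.symm_apply_eq]
  have h₁ : ∀ j, (A (σ j) \ C j).card = ∑ u ∈ A (σ j), if t u = j then 0 else 1 := fun j => by
    rw [Finset.sdiff_eq_filter, Finset.card_filter]
    exact Finset.sum_congr rfl fun u _ => by simp [ht, ite_not]
  have h₂ : ∀ j, (C j \ A (σ j)).card = ∑ u ∈ C j, if a u = σ j then 0 else 1 := fun j => by
    rw [Finset.sdiff_eq_filter, Finset.card_filter]
    exact Finset.sum_congr rfl fun u _ => by simp [ha, ite_not]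
  simp only [h₁, h₂, Finset.sum_add_distrib]
  rw [sum_parts_eq_sum_label haσ (fun j u => if t u = j then 0 else 1),
    sum_parts_eq_sum_label ht (fun j u => if a u = σ j then 0 else 1),
    Finset.card_filter, two_mul]
  congr 1
  · refine Finset.sum_congr rfl fun u _ => ?_
    simp only [Equiv.eq_symm_apply, ne_eq, ite_not, eq_comm]
  · exact Finset.sum_congr rfl fun u _ => by simp only [ne_eq, ite_not]

/-- There is an absolute constant `C₀ > 0` such that: if the rows of `Q` are constant
on each true cluster `C_j` with pairwise distances at least `θ` between the cluster
values, and the rows of `P` are `Δ`-close to those of `Q` in total squared distance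
with `Δ ≤ nθ²/(100(C₁+1))`, then any `C₁`-approximate `k`-means clustering of the
rows of `P` misclassifies at most `C₀·C₁·Δ/θ²` vertices. -/
theorem kmeans_misclassification_bound :
    ∃ C₀ : ℝ, 0 < C₀ ∧
      ∀ (k n N d : ℕ), N = k * n → 1 ≤ n →
      ∀ (C : Fin k → Finset (Fin N)), IsKPartition C → (∀ j, (C j).card = n) →
      ∀ (θ : ℝ), 0 < θ →
      ∀ (c : Fin k → EuclideanSpace ℝ (Fin d)),
        (∀ j l, j ≠ l → θ ≤ ‖c j - c l‖) →
      ∀ (Q P : Fin N → EuclideanSpace ℝ (Fin d)),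
        (∀ j, ∀ u ∈ C j, Q u = c j) →
      ∀ (Δ : ℝ), (∑ u, ‖P u - Q u‖ ^ 2) ≤ Δ →
      ∀ (C₁ : ℝ), 1 ≤ C₁ → Δ ≤ n * θ ^ 2 / (100 * (C₁ + 1)) →
      ∀ (A : Fin k → Finset (Fin N)) (z : Fin k → EuclideanSpace ℝ (Fin d)),
        IsKPartition A →
        (∀ (B : Fin k → Finset (Fin N)) (w : Fin k → EuclideanSpace ℝ (Fin d)),
          IsKPartition B →
          (∑ j, ∑ u ∈ A j, ‖P u - z j‖ ^ 2) ≤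
            C₁ * ∑ j, ∑ u ∈ B j, ‖P u - w j‖ ^ 2) →
      ∃ σ : Equiv.Perm (Fin k),
        ((∑ j, ((A (σ j) \ C j).card + (C j \ A (σ j)).card) : ℕ) : ℝ)
          ≤ C₀ * C₁ * Δ / θ ^ 2 := by
  refine ⟨32, by norm_num, ?_⟩
  intro k n N d _ hn C hC hcard θ hθ c hc Q P hQ Δ hΔ C₁ hC₁ hsmall A z hA hopt
  obtain ⟨t, ht⟩ := hC.exists_label
  obtain ⟨a, ha⟩ := hA.exists_label
  have hQt : ∀ u, Q u = c (t u) := fun u => hQ _ u ((ht u _).mpr rfl)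
  have hΔ0 : 0 ≤ Δ := le_trans (Finset.sum_nonneg fun _ _ => sq_nonneg _) hΔ
  have hcost : ∑ u, ‖P u - z (a u)‖ ^ 2 ≤ C₁ * Δ := by
    have h := hopt C c hC
    rw [sum_parts_eq_sum_label ha (fun j u => ‖P u - z j‖ ^ 2),
      sum_parts_eq_sum_label ht (fun j u => ‖P u - c j‖ ^ 2)] at h
    simp only [← hQt] at h
    exact h.trans (mul_le_mul_of_nonneg_left hΔ (by linarith))
  have hdist : ∑ u, ‖z (a u) - c (t u)‖ ^ 2 ≤ 2 * (C₁ + 1) * Δ := by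
    have hpt : ∀ u, ‖z (a u) - c (t u)‖ ^ 2 ≤
        2 * ‖P u - z (a u)‖ ^ 2 + 2 * ‖P u - Q u‖ ^ 2 := fun u => by
      have htri : ‖z (a u) - c (t u)‖ ≤ ‖P u - z (a u)‖ + ‖P u - Q u‖ := by
        rw [← hQt, norm_sub_rev (P u) (z (a u))]
        exact norm_sub_le_norm_sub_add_norm_sub _ _ _
      nlinarith [norm_nonneg (z (a u) - c (t u)), sq_nonneg (‖P u - z (a u)‖ - ‖P u - Q u‖)]
    calc ∑ u, ‖z (a u) - c (t u)‖ ^ 2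
        ≤ ∑ u, (2 * ‖P u - z (a u)‖ ^ 2 + 2 * ‖P u - Q u‖ ^ 2) :=
          Finset.sum_le_sum fun u _ => hpt u
      _ = 2 * ∑ u, ‖P u - z (a u)‖ ^ 2 + 2 * ∑ u, ‖P u - Q u‖ ^ 2 := by
          rw [Finset.sum_add_distrib, Finset.mul_sum, Finset.mul_sum]
      _ ≤ 2 * (C₁ + 1) * Δ := by linarith
  have hdist_small : ∑ u, ‖z (a u) - c (t u)‖ ^ 2 ≤ n * (θ ^ 2 / 50) := by
    rw [le_div_iff₀ (by linarith)] at hsmall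
    linarith
  have hclose : ∀ j, ∃ i, ‖z i - c j‖ ≤ θ / 4 := fun j => by
    by_contra! hfar
    have hlt : ∑ u ∈ C j, θ ^ 2 / 50 < ∑ u ∈ C j, ‖z (a u) - c (t u)‖ ^ 2 := by
      refine Finset.sum_lt_sum_of_nonempty (Finset.card_pos.mp (by rw [hcard]; exact hn)) ?_
      intro u hu
      rw [(ht u j).mp hu]
      nlinarith [hfar (a u)]
    have hle : ∑ u ∈ C j, ‖z (a u) - c (t u)‖ ^ 2 ≤ ∑ u, ‖z (a u) - c (t u)‖ ^ 2 :=
      Finset.sum_le_sum_of_subset_of_nonneg (Finset.subset_univ _) fun _ _ _ => sq_nonneg _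
    rw [Finset.sum_const, hcard, nsmul_eq_mul] at hlt
    linarith
  choose s hs using hclose
  have hsinj : Function.Injective s := fun j l hjl => by
    by_contra hne
    have htri := norm_sub_le_norm_sub_add_norm_sub (c j) (z (s j)) (c l)
    have hj := hs j
    have hl := hs l
    rw [← hjl] at hl
    rw [norm_sub_rev] at hj
    linarith [hc j l hne]
  let σ : Equiv.Perm (Fin k) := Equiv.ofBijective s (Finite.injective_iff_bijective.mp hsinj)
  refine ⟨σ, ?_⟩
  rw [sum_card_sdiff_eq_two_mul_card_label_ne ha ht σ]
  set B := Finset.univ.filter (fun u => a u ≠ σ (t u))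
  have hbad : ∀ u ∈ B, θ ^ 2 / 4 ≤ ‖z (a u) - c (t u)‖ ^ 2 := fun u hu => by
    have hne : a u ≠ σ (t u) := (Finset.mem_filter.mp hu).2
    obtain ⟨l, hl⟩ := σ.surjective (a u)
    have hlt : l ≠ t u := fun h => hne (by rw [← hl, h])
    have hzl : ‖z (a u) - c l‖ ≤ θ / 4 := hl ▸ hs l
    have htri := norm_sub_le_norm_sub_add_norm_sub (c l) (z (a u)) (c (t u))
    rw [norm_sub_rev] at hzl
    nlinarith [hc l (t u) hlt]
  have hB : (B.card : ℝ) * (θ ^ 2 / 4) ≤ 2 * (C₁ + 1) * Δ :=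
    calc (B.card : ℝ) * (θ ^ 2 / 4) = ∑ _u ∈ B, θ ^ 2 / 4 := by
          rw [Finset.sum_const, nsmul_eq_mul]
      _ ≤ ∑ u ∈ B, ‖z (a u) - c (t u)‖ ^ 2 := Finset.sum_le_sum hbad
      _ ≤ ∑ u, ‖z (a u) - c (t u)‖ ^ 2 :=
          Finset.sum_le_sum_of_subset_of_nonneg (Finset.subset_univ _) fun _ _ _ => sq_nonneg _
      _ ≤ 2 * (C₁ + 1) * Δ := hdist
  rw [le_div_iff₀ (by positivity)]
  push_cast
  nlinarith [mul_nonneg (sub_nonneg.mpr hC₁) hΔ0]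
end
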